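/- arXiv:math/0112082 — 3 statements merged into one kernel-verified Lean document; each statement's English description precedes it below -/
import Mathlib

section
/- Let S ⊆ ℂ^p × ℂ^q be pluripolar. Then the set A := {z ∈ ℂ^p : the fiber S_{(z,·)} := {w ∈ ℂ^q : (z,w) ∈ S} is not pluripolar} is pluripolar. -/
open Set Metric Filter

noncomputable section

section BasicDefs

variable {E : Type*} [NormedAddCommGroup E] [NormedSpace ℂ E]

/-- `u` is plurisubharmonic on the open set `Ω` : it is `[-∞,∞)`-valued on `Ω`, upper
semicontinuous on `Ω`, and its restriction to each complex line is subharmonic there; the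
latter is expressed by the classical harmonic-majorant criterion: on every closed disc
(in the line parameter) contained in `Ω`, `u` is dominated by every function harmonic inside
the disc and continuous up to the boundary (written as the real part of a holomorphic
function, the disc being simply connected) that dominates `u` on the boundary circle. -/
def PshOn (u : E → EReal) (Ω : Set E) : Prop :=
  (∀ x ∈ Ω, u x < ⊤) ∧ UpperSemicontinuousOn u Ω ∧
  ∀ (a b : E) (c : ℂ) (r : ℝ), 0 < r →
    (∀ t ∈ closedBall c r, a + t • b ∈ Ω) →
    ∀ f : ℂ → ℂ, ContinuousOn f (closedBall c r) →
      DifferentiableOn ℂ f (ball c r) →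
      (∀ t ∈ sphere c r, u (a + t • b) ≤ ((f t).re : EReal)) →
      ∀ t ∈ closedBall c r, u (a + t • b) ≤ ((f t).re : EReal)

/-- A set `P` is pluripolar if `P ⊆ u⁻¹(-∞)` for some plurisubharmonic `u ≢ -∞` on the
whole space. -/
def Pluripolar (P : Set E) : Prop :=
  ∃ u : E → EReal, PshOn u univ ∧ (¬ ∀ x, u x = ⊥) ∧ ∀ x ∈ P, u x = ⊥

/-- The defining family of the relative extremal function `h_{A,Ω}`. -/
def extrFamily (A Ω : Set E) : Set (E → EReal) :=
  {u | PshOn u Ω ∧ (∀ x ∈ Ω, u x ≤ 1) ∧ ∀ x ∈ A, u x ≤ 0}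

/-- The relative extremal function `h_{A,Ω}`. -/
def relExtr (A Ω : Set E) (z : E) : EReal :=
  ⨆ u ∈ extrFamily A Ω, u z

/-- Upper semicontinuous regularization `u*`. -/
def uscReg (u : E → EReal) (z : E) : EReal :=
  Filter.limsup u (nhds z)

/-- `h*_{A,Ω}`. -/
def relExtrStar (A Ω : Set E) (z : E) : EReal :=
  uscReg (relExtr A Ω) z

/-- A canonical exhaustion of an open set `Ω` by relatively compact open subsets
`Ω_k ⊆ Ω_{k+1} ⋐ Ω` with `⋃ k, Ω_k = Ω`. -/
def exhaust (Ω : Set E) (k : ℕ) : Set E :=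
  {x | ‖x‖ < (k : ℝ) + 1 ∧ closedBall x (1 / ((k : ℝ) + 1)) ⊆ Ω}

/-- `ω_{A,Ω} = lim_k h*_{A∩Ω_k,Ω_k}` (a decreasing limit, hence the infimum) along an
exhaustion of `Ω`; the limit is independent of the chosen exhaustion. -/
def omegaRel (A Ω : Set E) (z : E) : EReal :=
  ⨅ k : ℕ, relExtrStar (A ∩ exhaust Ω k) (exhaust Ω k) z

/-- `A` is locally pluriregular: `A ≠ ∅` and `h*_{A∩Ω,Ω}(a) = 0` for every `a ∈ A` and every
open neighborhood `Ω` of `a`. -/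
def LocPluriregular (A : Set E) : Prop :=
  A.Nonempty ∧ ∀ a ∈ A, ∀ Ω : Set E, IsOpen Ω → a ∈ Ω → relExtrStar (A ∩ Ω) Ω a = 0

/-- An open set `Ω` is pseudoconvex if `Ω` is the whole space or
`z ↦ -log dist(z, ∂Ω)` is plurisubharmonic on `Ω`. -/
def Pseudoconvex (Ω : Set E) : Prop :=
  IsOpen Ω ∧ (Ω = univ ∨
    PshOn (fun z => ((- Real.log (infDist z Ωᶜ) : ℝ) : EReal)) Ω)

/-- `M` is a relatively closed subset of `U`. -/
def RelClosedIn (M U : Set E) : Prop :=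
  M ⊆ U ∧ closure M ∩ U ⊆ M

/-- `g ∈ O(Ω)` admits no holomorphic extension to any neighborhood of `a`. -/
def NoHolExtAt (g : E → ℂ) (Ω : Set E) (a : E) : Prop :=
  ¬ ∃ (V : Set E) (h : E → ℂ), IsOpen V ∧ a ∈ V ∧
      DifferentiableOn ℂ h V ∧ ∀ x ∈ V ∩ Ω, h x = g x

end BasicDefs

section TwoFold

variable {E F : Type*} [NormedAddCommGroup E] [NormedSpace ℂ E]
  [NormedAddCommGroup F] [NormedSpace ℂ F]

/-- The 2-fold cross `𝕏(A,B;D,G) = (A×G) ∪ (D×B)`. -/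
def Cross2 (A : Set E) (B : Set F) (D : Set E) (G : Set F) : Set (E × F) :=
  (A ×ˢ G) ∪ (D ×ˢ B)

/-- `X̂ = {(z,w) ∈ D×G : ω_{A,D}(z) + ω_{B,G}(w) < 1}`. -/
def CrossHat2 (A : Set E) (B : Set F) (D : Set E) (G : Set F) : Set (E × F) :=
  {p | p.1 ∈ D ∧ p.2 ∈ G ∧ omegaRel A D p.1 + omegaRel B G p.2 < 1}

/-- `f ∈ O_s(X∖M)` for the 2-fold cross `X = 𝕏(A,B;D,G)`. -/
def SepHol2 (A : Set E) (B : Set F) (D : Set E) (G : Set F) (M : Set (E × F))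
    (f : E × F → ℂ) : Prop :=
  (∀ a ∈ A, DifferentiableOn ℂ (fun w => f (a, w)) (G \ {w | (a, w) ∈ M})) ∧
  (∀ b ∈ B, DifferentiableOn ℂ (fun z => f (z, b)) (D \ {z | (z, b) ∈ M}))

end TwoFold

section NFold

variable {N : ℕ} {n : Fin N → ℕ}

/-- The `N`-fold cross `𝕏(A_1,…,A_N;D_1,…,D_N)`. -/
def CrossN (A D : ∀ j : Fin N, Set (Fin (n j) → ℂ)) : Set (∀ j, Fin (n j) → ℂ) :=
  {z | ∃ j, z j ∈ D j ∧ ∀ i, i ≠ j → z i ∈ A i}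

/-- `X̂ := {(z_1,…,z_N) ∈ D_1×⋯×D_N : Σ_j ω_{A_j,D_j}(z_j) < 1}`. -/
def CrossHatN (A D : ∀ j : Fin N, Set (Fin (n j) → ℂ)) : Set (∀ j, Fin (n j) → ℂ) :=
  {z | (∀ j, z j ∈ D j) ∧ ∑ j, omegaRel (A j) (D j) (z j) < 1}

/-- Insert the value `w` in the `j`-th slot of the partial tuple `y`. -/
def glueAt (j : Fin N) (y : ∀ i : {i : Fin N // i ≠ j}, Fin (n i.1) → ℂ)
    (w : Fin (n j) → ℂ) : ∀ i, Fin (n i) → ℂ :=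
  fun i => if h : i = j then cast (by rw [h]) w else y ⟨i, h⟩

/-- Forget the `j`-th slot of a tuple. -/
def dropAt (j : Fin N) (z : ∀ i, Fin (n i) → ℂ) :
    ∀ i : {i : Fin N // i ≠ j}, Fin (n i.1) → ℂ :=
  fun i => z i.1

/-- `Σ_j = {(z',z'') ∈ (A_1×⋯×A_{j-1})×(A_{j+1}×⋯×A_N) : M_{(z',·,z'')} not pluripolar}`. -/
def SigmaSet (A : ∀ j : Fin N, Set (Fin (n j) → ℂ)) (M : Set (∀ j, Fin (n j) → ℂ))
    (j : Fin N) : Set (∀ i : {i : Fin N // i ≠ j}, Fin (n i.1) → ℂ) :=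
  {y | (∀ i, y i ∈ A i.1) ∧ ¬ Pluripolar {w : Fin (n j) → ℂ | glueAt j y w ∈ M}}

/-- The generalized `N`-fold cross `𝕋(A_1,…,A_N;D_1,…,D_N;S_1,…,S_N)`. -/
def CrossT (A D : ∀ j : Fin N, Set (Fin (n j) → ℂ))
    (S : ∀ j : Fin N, Set (∀ i : {i : Fin N // i ≠ j}, Fin (n i.1) → ℂ)) :
    Set (∀ j, Fin (n j) → ℂ) :=
  {z | ∃ j, z j ∈ D j ∧ (∀ i, i ≠ j → z i ∈ A i) ∧ dropAt j z ∉ S j}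

/-- `f ∈ O_s(X∖M)` for the `N`-fold cross `X = 𝕏(A_1,…,A_N;D_1,…,D_N)`. -/
def SepHolN (A D : ∀ j : Fin N, Set (Fin (n j) → ℂ)) (M : Set (∀ j, Fin (n j) → ℂ))
    (f : (∀ j, Fin (n j) → ℂ) → ℂ) : Prop :=
  ∀ (j : Fin N) (a : ∀ i, Fin (n i) → ℂ), (∀ i, a i ∈ A i) →
    DifferentiableOn ℂ (fun w => f (Function.update a j w))
      (D j \ {w | Function.update a j w ∈ M})

/-- `f ∈ O_s(T)` for the generalized cross `T = 𝕋(A;D;S)`. -/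
def SepHolT (A D : ∀ j : Fin N, Set (Fin (n j) → ℂ))
    (S : ∀ j : Fin N, Set (∀ i : {i : Fin N // i ≠ j}, Fin (n i.1) → ℂ))
    (f : (∀ j, Fin (n j) → ℂ) → ℂ) : Prop :=
  ∀ (j : Fin N) (y : ∀ i : {i : Fin N // i ≠ j}, Fin (n i.1) → ℂ),
    (∀ i, y i ∈ A i.1) → y ∉ S j →
    DifferentiableOn ℂ (fun w => f (glueAt j y w)) (D j)

end NFold

section Slices

variable {E F : Type*} [NormedAddCommGroup E] [NormedSpace ℂ E]
  [NormedAddCommGroup F] [NormedSpace ℂ F]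

/-- Plurisubharmonicity is preserved by precomposition with a continuous map which is affine
with linear part `L`. -/
theorem PshOn.comp_affine {u : F → EReal} (hu : PshOn u univ) (φ : E → F) (L : E →ₗ[ℂ] F)
    (hφ : Continuous φ) (hL : ∀ a v, φ (a + v) = φ a + L v) :
    PshOn (fun x => u (φ x)) univ := by
  obtain ⟨htop, husc, hsub⟩ := hu
  refine ⟨fun x _ => htop _ (mem_univ _), ?_, fun a b c r hr _ f hfc hfd hf t ht => ?_⟩
  · rw [upperSemicontinuousOn_univ_iff] at husc ⊢
    exact husc.comp hφ
  · have key : ∀ s : ℂ, φ (a + s • b) = φ a + s • L b := fun s => by rw [hL, map_smul]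
    simp only [key] at hf ⊢
    exact hsub (φ a) (L b) c r hr (fun _ _ => mem_univ _) f hfc hfd hf t ht

theorem PshOn.slice_right {u : E × F → EReal} (hu : PshOn u univ) (z : E) :
    PshOn (fun w => u (z, w)) univ :=
  hu.comp_affine (fun w => (z, w)) (LinearMap.inr ℂ E F) (by fun_prop) (by simp)

theorem PshOn.slice_left {u : E × F → EReal} (hu : PshOn u univ) (w : F) :
    PshOn (fun z => u (z, w)) univ :=
  hu.comp_affine (fun z => (z, w)) (LinearMap.inl ℂ E F) (by fun_prop) (by simp)

end Slices

/-- **Lemma 8(a).** If `S ⊆ ℂ^p × ℂ^q` is pluripolar, then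
`A := {z ∈ ℂ^p : S_{(z,·)} is not pluripolar}` is pluripolar. -/
theorem lemma_eight_a
    (p q : ℕ) (S : Set ((Fin p → ℂ) × (Fin q → ℂ))) (hS : Pluripolar S) :
    Pluripolar {z : Fin p → ℂ | ¬ Pluripolar {w : Fin q → ℂ | (z, w) ∈ S}} := by
  obtain ⟨u, hu, hne, hS⟩ := hS
  push Not at hne
  obtain ⟨⟨z₀, w₀⟩, h₀⟩ := hne
  refine ⟨fun z => u (z, w₀), hu.slice_left w₀, fun h => h₀ (h z₀), fun z hz => ?_⟩
  by_contra hzw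
  exact hz ⟨fun w => u (z, w), hu.slice_right z, fun h => hzw (h w₀), fun w hw => hS _ hw⟩
end
end

section
/- Let M ⊆ ℂ^p × ℂ^q be such that for every a ∈ ℂ^p the fiber M_{(a,·)} := {w ∈ ℂ^q : (a,w) ∈ M} is pluripolar, and let A ⊆ ℂ^p be locally pluriregular. Then the set C := {(a,b') ∈ A × ℂ^{q-1} : the fiber M_{(a,b',·)} := {w_q ∈ ℂ : (a,b',w_q) ∈ M} is polar} is locally pluriregular. -/
open Set Metric Filter

noncomputable section

open MeasureTheory

theorem exists_differentiable_re_near_on_sphere {c : ℂ} {r : ℝ} (hr : 0 < r) {φ : ℂ → ℝ}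
    (hφ : Continuous φ) {ε : ℝ} (hε : 0 < ε) :
    ∃ f : ℂ → ℂ, Differentiable ℂ f ∧ ∀ z ∈ sphere c r, |(f z).re - φ z| < ε := by
  let γ : UnitAddCircle → ℂ := fun x => c + r * (AddCircle.toCircle x : ℂ)
  have hγ : Continuous γ := by
    have := AddCircle.continuous_toCircle (T := 1)
    fun_prop
  let g : C(UnitAddCircle, ℂ) := ⟨fun x => (φ (γ x) : ℂ), by fun_prop⟩
  let V : Submodule ℂ C(UnitAddCircle, ℂ) :=
    { carrier := {h | ∀ a : ℂ, ∃ f : ℂ → ℂ, Differentiable ℂ f ∧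
        ∀ x, (f (γ x)).re = (a * h x).re}
      add_mem' := by
        intro h₁ h₂ H₁ H₂ a
        obtain ⟨f₁, hf₁, e₁⟩ := H₁ a
        obtain ⟨f₂, hf₂, e₂⟩ := H₂ a
        refine ⟨fun z => f₁ z + f₂ z, hf₁.add hf₂, fun x => ?_⟩
        simp only [Complex.add_re, e₁, e₂, ContinuousMap.add_apply, mul_add]
      zero_mem' := fun a => ⟨fun _ => 0, by fun_prop, by simp⟩
      smul_mem' := by
        intro b h H a
        obtain ⟨f, hf, e⟩ := H (a * b)
        exact ⟨f, hf, fun x => by rw [e, ContinuousMap.smul_apply, smul_eq_mul, mul_assoc]⟩ }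
  have hpow : ∀ (n : ℕ) (x : UnitAddCircle),
      ((γ x - c) / r) ^ n = fourier (n : ℤ) x := by
    intro n x
    have : (r : ℂ) ≠ 0 := by exact_mod_cast hr.ne'
    rw [fourier_apply, natCast_zsmul, AddCircle.toCircle_nsmul]
    simp [γ, this]
  have hV : Submodule.span ℂ (range (@fourier 1)) ≤ V := by
    rw [Submodule.span_le]
    rintro _ ⟨n, rfl⟩ a
    obtain ⟨n, rfl | rfl⟩ := n.eq_nat_or_neg
    · exact ⟨fun z => a * ((z - c) / r) ^ n, by fun_prop, fun x => by simp only [hpow]⟩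
    · refine ⟨fun z => (starRingEnd ℂ) a * ((z - c) / r) ^ n, by fun_prop, fun x => ?_⟩
      simp only [hpow]
      rw [fourier_neg, ← Complex.conj_re (a * _), map_mul, Complex.conj_conj]
  have hg : g ∈ closure (Submodule.span ℂ (range (@fourier 1)) : Set C(UnitAddCircle, ℂ)) := by
    rw [← Submodule.topologicalClosure_coe, span_fourier_closure_eq_top]
    trivial
  obtain ⟨h, hh, hgh⟩ := Metric.mem_closure_iff.1 hg ε hε
  obtain ⟨f, hf, e⟩ := hV hh 1
  refine ⟨f, hf, fun z hz => ?_⟩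
  have hz' : ‖(z - c) / r‖ = 1 := by
    rw [norm_div, ← dist_eq_norm, mem_sphere.1 hz, Complex.norm_of_nonneg hr.le, div_self hr.ne']
  obtain ⟨x, hx⟩ := (AddCircle.homeomorphCircle (one_ne_zero (α := ℝ))).surjective
    ⟨(z - c) / r, mem_sphere_zero_iff_norm.2 hz'⟩
  rw [AddCircle.homeomorphCircle_apply] at hx
  have hzx : z = γ x := by
    have : (r : ℂ) ≠ 0 := by exact_mod_cast hr.ne'
    simp only [γ, hx]
    field_simp
    ring
  have h1 : (f z).re - φ z = (h x - g x).re := by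
    rw [hzx, e]
    simp [g]
  rw [h1]
  calc |(h x - g x).re| ≤ ‖h x - g x‖ := Complex.abs_re_le_norm _
    _ = dist (g x) (h x) := by rw [dist_comm, dist_eq_norm]
    _ ≤ dist g h := ContinuousMap.dist_apply_le_dist x
    _ < ε := hgh

theorem PshOn.le_circleAverage {u : ℂ → EReal} {Ω : Set ℂ} (hu : PshOn u Ω) {c : ℂ} {r : ℝ}
    (hr : 0 < r) (hΩ : closedBall c r ⊆ Ω) {φ : ℂ → ℝ} (hφ : Continuous φ)
    (h : ∀ z ∈ sphere c r, u z ≤ φ z) : u c ≤ (Real.circleAverage φ c r : ℝ) := by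
  by_contra! hlt
  obtain ⟨x, hx, hxu⟩ := EReal.lt_iff_exists_real_btwn.1 hlt
  rw [EReal.coe_lt_coe_iff] at hx
  set ε := (x - Real.circleAverage φ c r) / 2 with hε
  have hεpos : 0 < ε := by linarith
  obtain ⟨f, hf, hfφ⟩ := exists_differentiable_re_near_on_sphere (c := c) hr hφ hεpos
  have key := hu.2.2 0 1 c r hr (fun t ht => by simpa using hΩ ht) (fun z => f z + ε)
    (hf.add_const _).continuous.continuousOn (hf.add_const _).differentiableOn (fun t ht => by
      simp only [zero_add, smul_eq_mul, mul_one]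
      refine (h t ht).trans (EReal.coe_le_coe_iff.2 ?_)
      have := abs_lt.1 (hfφ t ht)
      simp only [Complex.add_re, Complex.ofReal_re]
      linarith) c (mem_closedBall_self hr.le)
  simp only [zero_add, smul_eq_mul, mul_one, Complex.add_re, Complex.ofReal_re] at key
  have hcont : Continuous fun z => (f z).re := by have := hf.continuous; fun_prop
  have hre : Real.circleAverage (fun z => (f z).re) c r = (f c).re := by
    have h1 := (hf.diffContOnCl (s := ball c |r|)).circleAverage
    have h2 := Complex.reCLM.circleAverage_comp_comm (f := f) (c := c) (R := r)
      hf.continuous.continuousOn.circleIntegrable'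
    rw [h1] at h2
    exact h2
  have hle : (f c).re ≤ Real.circleAverage φ c r + ε := by
    have h3 : Real.circleAverage (fun z => φ z + ε) c r = Real.circleAverage φ c r + ε := by
      rw [Real.circleAverage_fun_add hφ.continuousOn.circleIntegrable'
        continuous_const.continuousOn.circleIntegrable', Real.circleAverage_const]
    rw [← hre, ← h3]
    refine Real.circleAverage_mono hcont.continuousOn.circleIntegrable'
      (by fun_prop : Continuous fun z => φ z + ε).continuousOn.circleIntegrable' fun z hz => ?_
    rw [abs_of_pos hr] at hz
    have := abs_lt.1 (hfφ z hz)
    linarith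
  have : x < (f c).re + ε := EReal.coe_lt_coe_iff.1 (hxu.trans_le key)
  linarith

/-- Arc length (by angle) on the circle of centre `c` and radius `r`. -/
def circleMeasure (c : ℂ) (r : ℝ) : Measure ℂ :=
  (volume.restrict (Ioo (-Real.pi) Real.pi)).map (circleMap c r)

instance (c : ℂ) (r : ℝ) : IsFiniteMeasure (circleMeasure c r) := by
  unfold circleMeasure
  infer_instance

theorem circleMeasure_univ (c : ℂ) (r : ℝ) :
    circleMeasure c r univ = ENNReal.ofReal (2 * Real.pi) := by
  rw [circleMeasure, Measure.map_apply (by fun_prop) MeasurableSet.univ]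
  simp only [preimage_univ, Measure.restrict_apply_univ, Real.volume_Ioo]
  ring_nf

theorem circleAverage_eq_integral_circleMeasure {φ : ℂ → ℝ} (hφ : Continuous φ) (c : ℂ) (r : ℝ) :
    Real.circleAverage φ c r = (2 * Real.pi)⁻¹ * ∫ z, φ z ∂circleMeasure c r := by
  rw [Real.circleAverage_eq_integral_add (-Real.pi), circleMeasure,
    integral_map (by fun_prop) hφ.aestronglyMeasurable,
    ← integral_Ioc_eq_integral_Ioo, ← intervalIntegral.integral_of_le (by linarith [Real.pi_pos]),
    intervalIntegral.integral_comp_add_right (fun θ => φ (circleMap c r θ)) (-Real.pi), smul_eq_mul]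
  congr 3 <;> ring

theorem circleMeasure_compl_sphere (c : ℂ) {r : ℝ} (hr : 0 < r) :
    circleMeasure c r (sphere c r)ᶜ = 0 := by
  rw [circleMeasure, Measure.map_apply (by fun_prop) isClosed_sphere.measurableSet.compl]
  have : circleMap c r ⁻¹' (sphere c r)ᶜ = ∅ := by
    ext θ
    simp [abs_of_pos hr]
  rw [this, measure_empty]

theorem PshOn.le_add_mul_measure {u : ℂ → EReal} {Ω : Set ℂ} (hu : PshOn u Ω) {c : ℂ} {r : ℝ}
    (hr : 0 < r) (hΩ : closedBall c r ⊆ Ω) {s M : ℝ} (hsM : s ≤ M)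
    (hM : ∀ z ∈ sphere c r, u z ≤ M) :
    u c ≤ ((s + (M - s) * ((2 * Real.pi)⁻¹ *
      (circleMeasure c r).real (sphere c r ∩ u ⁻¹' Ici (s : EReal))) : ℝ) : EReal) := by
  set μ := circleMeasure c r
  set F := sphere c r ∩ u ⁻¹' Ici (s : EReal)
  have hF : IsClosed F := ((hu.2.1.mono (sphere_subset_closedBall.trans
    hΩ)).isCompact_inter_preimage_Ici (isCompact_sphere c r) _).isClosed
  have δpos : ∀ n : ℕ, 0 < 1 / ((n : ℝ) + 1) := fun n => by positivity
  have lim := tendsto_lintegral_thickenedIndicator_of_isClosed μ hF δpos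
    tendsto_one_div_add_atTop_nhds_zero_nat
  have lim' := (ENNReal.tendsto_toReal (measure_ne_top μ F)).comp lim
  refine ge_of_tendsto' ((continuous_coe_real_ereal.tendsto _).comp
    (((lim'.const_mul (2 * Real.pi)⁻¹).const_mul (M - s)).const_add s)) fun n => ?_
  set χ := thickenedIndicator (δpos n) F
  have hχ : Continuous fun z => (χ z : ℝ) := NNReal.continuous_coe.comp χ.continuous
  refine (hu.le_circleAverage hr hΩ (φ := fun z => s + (M - s) * χ z) (by fun_prop)
    fun z hz => ?_).trans ?_
  · by_cases hzF : z ∈ F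
    · have : χ z = 1 := thickenedIndicator_one (δpos n) F hzF
      simpa [this] using hM z hz
    · have hlt : u z < s := by
        by_contra! hle
        exact hzF ⟨hz, hle⟩
      refine hlt.le.trans (EReal.coe_le_coe_iff.2 ?_)
      have := mul_nonneg (sub_nonneg.2 hsM) (χ z).2
      exact le_add_of_nonneg_right this
  · refine EReal.coe_le_coe_iff.2 (le_of_eq ?_)
    rw [Real.circleAverage_fun_add continuous_const.continuousOn.circleIntegrable'
      (by fun_prop : Continuous fun z => (M - s) * (χ z : ℝ)).continuousOn.circleIntegrable',
      Real.circleAverage_const,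
      circleAverage_eq_integral_circleMeasure (by fun_prop), integral_const_mul]
    have := BoundedContinuousFunction.toReal_lintegral_coe_eq_integral χ μ
    simp only [Function.comp_apply]
    rw [this]
    ring

theorem PshOn.exists_le_on_sphere {u : ℂ → EReal} {Ω : Set ℂ} (hu : PshOn u Ω) {c : ℂ} {r : ℝ}
    (hr : 0 < r) (hΩ : closedBall c r ⊆ Ω) : ∃ M : ℝ, ∀ z ∈ sphere c r, u z ≤ M := by
  have hs : sphere c r ⊆ Ω := sphere_subset_closedBall.trans hΩ
  obtain ⟨z₀, hz₀, hmax⟩ := (hu.2.1.mono hs).exists_isMaxOn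
    (NormedSpace.sphere_nonempty.2 hr.le) (isCompact_sphere c r)
  obtain ⟨M, hM, -⟩ := EReal.lt_iff_exists_real_btwn.1 (hu.1 z₀ (hs hz₀))
  exact ⟨M, fun z hz => (hmax hz).trans hM.le⟩

theorem PshOn.circleMeasure_eq_bot {v : ℂ → EReal} {Ω : Set ℂ} (hv : PshOn v Ω) {c : ℂ} {r : ℝ}
    (hr : 0 < r) (hΩ : closedBall c r ⊆ Ω) (hc : v c ≠ ⊥) :
    circleMeasure c r {z | v z = ⊥} = 0 := by
  obtain ⟨M, hM⟩ := hv.exists_le_on_sphere hr hΩ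
  lift v c to ℝ using ⟨(hv.1 c (hΩ (mem_closedBall_self hr.le))).ne, hc⟩ with x hx
  set μ := circleMeasure c r
  set m := μ.real {z | v z = ⊥}
  have hμ : μ.real univ = 2 * Real.pi := by
    rw [measureReal_def, circleMeasure_univ, ENNReal.toReal_ofReal Real.two_pi_pos.le]
  have key : ∀ N : ℝ, -N ≤ M → m * (M + N) ≤ 2 * Real.pi * (M - x) := by
    intro N hN
    have h1 := hv.le_add_mul_measure hr hΩ hN hM
    rw [← hx, EReal.coe_le_coe_iff] at h1
    set F := sphere c r ∩ v ⁻¹' Ici ((-N : ℝ) : EReal)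
    have hF : IsClosed F := ((hv.2.1.mono (sphere_subset_closedBall.trans
      hΩ)).isCompact_inter_preimage_Ici (isCompact_sphere c r) _).isClosed
    have h2 : m ≤ 2 * Real.pi - μ.real F := by
      rw [← hμ, ← measureReal_compl hF.measurableSet]
      refine measureReal_mono fun z hz hzF => ?_
      have h3 : ((-N : ℝ) : EReal) ≤ v z := hzF.2
      rw [show v z = ⊥ from hz] at h3
      exact EReal.coe_ne_bot _ (le_bot_iff.1 h3)
    have hpi := Real.two_pi_pos
    have h4 : 2 * Real.pi * x ≤ 2 * Real.pi * (-N) + (M + N) * μ.real F := by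
      calc 2 * Real.pi * x
          ≤ 2 * Real.pi * (-N + (M - -N) * ((2 * Real.pi)⁻¹ * μ.real F)) := by gcongr
        _ = _ := by
          field_simp
          ring
    have h5 := mul_le_mul_of_nonneg_right h2 (by linarith : 0 ≤ M + N)
    linarith
  have hm : m = 0 := by
    by_contra hne
    have hpos : 0 < m := lt_of_le_of_ne measureReal_nonneg (Ne.symm hne)
    have h1 := key (|2 * Real.pi * (M - x) / m| + 1 - M) (by
      have := abs_nonneg (2 * Real.pi * (M - x) / m)
      linarith)
    have h2 : 2 * Real.pi * (M - x) / m < |2 * Real.pi * (M - x) / m| + 1 :=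
      (le_abs_self _).trans_lt (lt_add_one _)
    rw [div_lt_iff₀ hpos] at h2
    linarith
  exact (measureReal_eq_zero_iff).1 hm

theorem PshOn.le_zero_of_ae_circleMeasure {u : ℂ → EReal} {Ω : Set ℂ} (hu : PshOn u Ω) {c : ℂ}
    {r : ℝ} (hr : 0 < r) (hΩ : closedBall c r ⊆ Ω) (h : ∀ᵐ z ∂circleMeasure c r, u z ≤ 0) :
    u c ≤ 0 := by
  obtain ⟨M, hM⟩ := hu.exists_le_on_sphere hr hΩ
  by_contra! hlt
  obtain ⟨ε, hε, hεu⟩ := EReal.lt_iff_exists_real_btwn.1 hlt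
  have h1 := hu.le_add_mul_measure hr hΩ (le_max_left ε M)
    fun z hz => (hM z hz).trans (EReal.coe_le_coe_iff.2 (le_max_right _ _))
  have h2 : (circleMeasure c r).real (sphere c r ∩ u ⁻¹' Ici (ε : EReal)) = 0 := by
    rw [measureReal_eq_zero_iff]
    refine measure_mono_null (fun z hz => ?_) (ae_iff.1 h)
    exact fun hz0 => absurd ((show (ε : EReal) ≤ u z from hz.2).trans hz0) hε.not_ge
  rw [h2, mul_zero, mul_zero, add_zero] at h1
  exact absurd h1 hεu.not_ge

theorem volume_eq_lintegral_circleMeasure {B : Set ℂ} (hB : MeasurableSet B) (c : ℂ) :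
    volume B = ∫⁻ r in Ioi (0 : ℝ), ENNReal.ofReal r * circleMeasure c r B := by
  have hB' : MeasurableSet ((fun z => c + z) ⁻¹' B) := measurableSet_preimage (by fun_prop) hB
  have hcont : Continuous fun p : ℝ × ℝ => circleMap c p.1 p.2 := by
    unfold circleMap
    fun_prop
  have hS : MeasurableSet {p : ℝ × ℝ | circleMap c p.1 p.2 ∈ B} := hcont.measurable hB
  rw [← measure_preimage_add volume c B, ← lintegral_indicator_one hB',
    ← Complex.lintegral_comp_polarCoord_symm, polarCoord_target, Measure.volume_eq_prod,
    ← Measure.prod_restrict]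
  have heq : ∀ p : ℝ × ℝ, ENNReal.ofReal p.1 •
      ((fun z => c + z) ⁻¹' B).indicator (1 : ℂ → ENNReal) (Complex.polarCoord.symm p) =
      ENNReal.ofReal p.1 * {p : ℝ × ℝ | circleMap c p.1 p.2 ∈ B}.indicator 1 p := by
    intro p
    have : c + Complex.polarCoord.symm p = circleMap c p.1 p.2 := by
      rw [Complex.polarCoord_symm_apply, circleMap, Complex.exp_mul_I]
      push_cast
      rfl
    have hiff : Complex.polarCoord.symm p ∈ (fun z => c + z) ⁻¹' B ↔
        p ∈ {p : ℝ × ℝ | circleMap c p.1 p.2 ∈ B} := by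
      rw [mem_preimage, this, mem_ofPred_eq]
    rw [smul_eq_mul]
    congr 1
    by_cases hp : p ∈ {p : ℝ × ℝ | circleMap c p.1 p.2 ∈ B}
    · rw [indicator_of_mem hp, indicator_of_mem (hiff.2 hp), Pi.one_apply, Pi.one_apply]
    · rw [indicator_of_notMem hp, indicator_of_notMem (hiff.not.2 hp)]
  simp_rw [heq]
  rw [lintegral_prod _ (by
    exact ((by fun_prop : Measurable fun p : ℝ × ℝ => ENNReal.ofReal p.1).mul
      (measurable_one.indicator hS)).aemeasurable)]
  refine lintegral_congr fun r => ?_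
  have hr : MeasurableSet (circleMap c r ⁻¹' B) := measurableSet_preimage (by fun_prop) hB
  rw [circleMeasure, Measure.map_apply (by fun_prop) hB, ← lintegral_indicator_one hr,
    ← lintegral_const_mul _ (measurable_one.indicator hr)]
  rfl

theorem PshOn.measurableSet_eq_bot {v : ℂ → EReal} (hv : PshOn v univ) :
    MeasurableSet {z | v z = ⊥} :=
  (upperSemicontinuousOn_univ_iff.1 hv.2.1).measurable (measurableSet_singleton ⊥)

theorem PshOn.volume_eq_bot {v : ℂ → EReal} (hv : PshOn v univ) {c : ℂ} (hc : v c ≠ ⊥) :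
    volume {z | v z = ⊥} = 0 := by
  rw [volume_eq_lintegral_circleMeasure hv.measurableSet_eq_bot c]
  refine (setLIntegral_congr_fun measurableSet_Ioi fun r hr => ?_).trans lintegral_zero
  simp only [hv.circleMeasure_eq_bot hr (subset_univ _) hc, mul_zero]

theorem PshOn.le_zero_of_le_zero_off_eq_bot {u v : ℂ → EReal} {Ω : Set ℂ} (hu : PshOn u Ω)
    (hΩ : IsOpen Ω) (hv : PshOn v univ) (hv' : ¬ ∀ z, v z = ⊥)
    (h : ∀ z ∈ Ω, v z ≠ ⊥ → u z ≤ 0) {c : ℂ} (hc : c ∈ Ω) : u c ≤ 0 := by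
  obtain ⟨z₁, hz₁⟩ := not_forall.1 hv'
  obtain ⟨R, hR, hRΩ⟩ := nhds_basis_closedBall.mem_iff.1 (hΩ.mem_nhds hc)
  have h0 := hv.volume_eq_bot hz₁
  have hmeas : Measurable fun r : ℝ => circleMeasure c r {z | v z = ⊥} := by
    have hS : MeasurableSet {p : ℝ × ℝ | v (circleMap c p.1 p.2) = ⊥} := by
      have hcont : Continuous fun p : ℝ × ℝ => circleMap c p.1 p.2 := by
        unfold circleMap
        fun_prop
      exact hcont.measurable hv.measurableSet_eq_bot
    convert measurable_measure_prodMk_left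
      (ν := volume.restrict (Ioo (-Real.pi) Real.pi)) hS using 2 with r
    rw [circleMeasure, Measure.map_apply (by fun_prop) hv.measurableSet_eq_bot]
    rfl
  rw [volume_eq_lintegral_circleMeasure hv.measurableSet_eq_bot c,
    lintegral_eq_zero_iff (by fun_prop), EventuallyEq, ae_restrict_iff' measurableSet_Ioi] at h0
  obtain ⟨r, ⟨hr0, hrR⟩, hr⟩ : ∃ r ∈ Ioo 0 R, circleMeasure c r {z | v z = ⊥} = 0 := by
    by_contra! hne
    have hpos : volume (Ioo 0 R) ≠ 0 := by simpa using hR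
    refine hpos (measure_mono_null (fun r hr => ?_) (ae_iff.1 h0))
    intro hr'
    have := hr' hr.1
    simp only [Pi.zero_apply, mul_eq_zero, ENNReal.ofReal_eq_zero] at this
    exact this.elim (fun h => absurd hr.1 h.not_gt) (hne r hr)
  have hsub : closedBall c r ⊆ Ω := (closedBall_subset_closedBall hrR.le).trans hRΩ
  refine hu.le_zero_of_ae_circleMeasure hr0 hsub ?_
  have hsph : ∀ᵐ z ∂circleMeasure c r, z ∈ sphere c r := circleMeasure_compl_sphere c hr0
  have hne : ∀ᵐ z ∂circleMeasure c r, v z ≠ ⊥ := by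
    rw [ae_iff]
    simpa using hr
  filter_upwards [hsph, hne] with z hz hz'
  exact h z (hsub (sphere_subset_closedBall hz)) hz'

section General

variable {E F : Type*} [NormedAddCommGroup E] [NormedSpace ℂ E]
  [NormedAddCommGroup F] [NormedSpace ℂ F]

theorem PshOn.comp_affine_s5 {u : F → EReal} {Ω : Set F} (hu : PshOn u Ω) (y : F) (T : E →L[ℂ] F)
    {Ω' : Set E} (hΩ : ∀ x ∈ Ω', y + T x ∈ Ω) : PshOn (fun x => u (y + T x)) Ω' := by
  refine ⟨fun x hx => hu.1 _ (hΩ x hx), fun x hx s hs => ?_, fun a b c r hr ht f hf hf' hb => ?_⟩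
  · have hcont : ContinuousWithinAt (fun x => y + T x) Ω' x := by fun_prop
    exact (hcont.tendsto_nhdsWithin hΩ).eventually (hu.2.1 _ (hΩ x hx) s hs)
  · have heq : ∀ t : ℂ, y + T (a + t • b) = y + T a + t • T b := fun t => by
      rw [map_add, map_smul, add_assoc]
    simp only [heq] at hb ⊢
    exact hu.2.2 _ _ c r hr (fun t htc => heq t ▸ hΩ _ (ht t htc)) f hf hf' hb

theorem pshOn_zero (Ω : Set E) : PshOn (fun _ : E => (0 : EReal)) Ω := by
  refine ⟨fun _ _ => EReal.zero_lt_top, upperSemicontinuousOn_const, ?_⟩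
  intro a b c r hr _ f hf hf' h t ht
  have hd : DiffContOnCl ℂ (fun z => Complex.exp (-f z)) (ball c r) :=
    ⟨hf'.neg.cexp, by rw [closure_ball c hr.ne']; exact hf.neg.cexp⟩
  have := Complex.norm_le_of_forall_mem_frontier_norm_le isBounded_ball hd (C := 1)
    (fun z hz => by
      rw [frontier_ball c hr.ne'] at hz
      have : 0 ≤ (f z).re := EReal.coe_nonneg.1 (h z hz)
      rw [Complex.norm_exp, Real.exp_le_one_iff, Complex.neg_re]
      linarith) (z := t) (by rwa [closure_ball c hr.ne'])
  rw [Complex.norm_exp, Real.exp_le_one_iff, Complex.neg_re] at this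
  exact EReal.coe_nonneg.2 (by linarith)

theorem PshOn.le_zero_of_le_zero_off_pluripolar {u : E → EReal} {Ω P : Set E} (hu : PshOn u Ω)
    (hΩ : IsOpen Ω) (hP : Pluripolar P) (h : ∀ x ∈ Ω \ P, u x ≤ 0) {b : E} (hb : b ∈ Ω) :
    u b ≤ 0 := by
  obtain ⟨v, hv, hv', hPv⟩ := hP
  obtain ⟨b₁, hb₁⟩ := not_forall.1 hv'
  let T : ℂ →L[ℂ] E := ContinuousLinearMap.toSpanSingleton ℂ (b₁ - b)
  let L : ℂ → E := fun t => b + T t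
  have hL : Continuous L := by fun_prop
  have h0 : L 0 = b := by simp [L]
  have h1 : L 1 = b₁ := by simp [L, T]
  have key := (hu.comp_affine_s5 b T (Ω' := L ⁻¹' Ω) fun t ht => ht).le_zero_of_le_zero_off_eq_bot
    (hΩ.preimage hL) (hv.comp_affine_s5 b T fun _ _ => mem_univ _)
    (fun hall => hb₁ (h1 ▸ hall 1)) (fun t ht hvt => h _ ⟨ht, fun hP => hvt (hPv _ hP)⟩)
    (c := 0) (show L 0 ∈ Ω by rwa [h0])
  have h0' : b + T 0 = b := h0
  rwa [h0'] at key

theorem Pluripolar.compl_nonempty {P : Set E} (hP : Pluripolar P) : Pᶜ.Nonempty := by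
  obtain ⟨v, -, hv', hPv⟩ := hP
  obtain ⟨b, hb⟩ := not_forall.1 hv'
  exact ⟨b, fun h => hb (hPv b h)⟩

theorem Pluripolar.not_pluripolar_fiber {P : Set (E × F)} (hP : Pluripolar P) :
    Pluripolar {x : E | ¬ Pluripolar {y : F | (x, y) ∈ P}} := by
  obtain ⟨v, hv, hv', hPv⟩ := hP
  obtain ⟨⟨x₀, y₀⟩, h₀⟩ := not_forall.1 hv'
  have hslice := hv.comp_affine_s5 (0, y₀) (ContinuousLinearMap.inl ℂ E F) (Ω' := univ)
    fun _ _ => mem_univ _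
  refine ⟨fun x => v (x, y₀), by simpa using hslice, fun hall => h₀ (hall x₀), fun x hx => ?_⟩
  by_contra hne
  have hfib := hv.comp_affine_s5 (x, 0) (ContinuousLinearMap.inr ℂ E F) (Ω' := univ)
    fun _ _ => mem_univ _
  exact hx ⟨fun y => v (x, y), by simpa using hfib, fun hall => hne (hall y₀),
    fun y hy => hPv _ hy⟩

theorem relExtr_nonneg (A Ω : Set E) (z : E) : 0 ≤ relExtr A Ω z :=
  le_iSup₂_of_le (fun _ => 0) ⟨pshOn_zero Ω, fun _ _ => zero_le_one, fun _ _ => le_rfl⟩ le_rfl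

theorem relExtrStar_nonneg (A Ω : Set E) (z : E) : 0 ≤ relExtrStar A Ω z := by
  calc (0 : EReal) = limsup (fun _ : E => (0 : EReal)) (nhds z) := limsup_const 0 |>.symm
    _ ≤ _ := limsup_le_limsup (Eventually.of_forall fun x => relExtr_nonneg A Ω x)

theorem locPluriregular_of_pluripolar_compl_fibers {A : Set E} (hA : LocPluriregular A)
    {P : E → Set F} (hP : ∀ a, Pluripolar (P a)) :
    LocPluriregular {c : E × F | c.1 ∈ A ∧ c.2 ∉ P c.1} := by
  obtain ⟨⟨a₀, ha₀⟩, hreg⟩ := hA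
  obtain ⟨b₀, hb₀⟩ := (hP a₀).compl_nonempty
  refine ⟨⟨(a₀, b₀), ha₀, hb₀⟩, ?_⟩
  rintro ⟨a, b⟩ ⟨ha, -⟩ Ω hΩ hab
  refine le_antisymm ?_ (relExtrStar_nonneg _ _ _)
  obtain ⟨U, V, hU, haU, hV, hbV, hUV⟩ := mem_nhds_prod_iff'.1 (hΩ.mem_nhds hab)
  set C := {c : E × F | c.1 ∈ A ∧ c.2 ∉ P c.1}
  have hle : ∀ x ∈ U, ∀ y ∈ V, relExtr (C ∩ Ω) Ω (x, y) ≤ relExtr (A ∩ U) U x := by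
    intro x hx y hy
    refine iSup₂_le fun u ⟨hu, hu1, hu0⟩ => ?_
    have hmem : (fun x' => u (x', y)) ∈ extrFamily (A ∩ U) U := by
      refine ⟨?_, fun x' hx' => hu1 _ (hUV ⟨hx', hy⟩), ?_⟩
      · have := hu.comp_affine_s5 (0, y) (ContinuousLinearMap.inl ℂ E F) (Ω' := U)
          fun x' hx' => hUV (by simpa using ⟨hx', hy⟩)
        simpa using this
      · rintro a' ⟨ha', ha'U⟩
        have hslice := hu.comp_affine_s5 (a', 0) (ContinuousLinearMap.inr ℂ E F) (Ω' := V)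
          fun y' hy' => hUV (by simpa using ⟨ha'U, hy'⟩)
        have := hslice.le_zero_of_le_zero_off_pluripolar hV (hP a')
          (fun y' hy' => hu0 _ (by
            simpa using ⟨(⟨ha', hy'.2⟩ : (a', y') ∈ C), hUV ⟨ha'U, hy'.1⟩⟩)) hy
        simpa using this
    exact le_iSup₂_of_le (f := fun (w : E → EReal) (_ : w ∈ extrFamily (A ∩ U) U) => w x)
      (fun x' => u (x', y)) hmem le_rfl
  calc relExtrStar (C ∩ Ω) Ω (a, b)
      ≤ limsup (fun c : E × F => relExtr (A ∩ U) U c.1) (nhds (a, b)) :=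
        limsup_le_limsup (by
          filter_upwards [(hU.prod hV).mem_nhds ⟨haU, hbV⟩] with c hc
          exact hle c.1 hc.1 c.2 hc.2)
    _ = limsup (relExtr (A ∩ U) U) (map Prod.fst (nhds (a, b))) := rfl
    _ = relExtrStar (A ∩ U) U a := by rw [map_fst_nhds]; rfl
    _ = 0 := hreg a ha U hU haU
    _ ≤ 0 := le_rfl

end General

/-- **Lemma 8(c).** Let `M ⊆ ℂ^p × ℂ^q` (with `ℂ^q = ℂ^{q-1} × ℂ`, here `q1 = q-1`) have all
fibers `M_{(a,·)}` (`a ∈ ℂ^p`) pluripolar, and let `A ⊆ ℂ^p` be locally pluriregular. Then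
`C := {(a,b') ∈ A × ℂ^{q-1} : M_{(a,b',·)} is polar}` is locally pluriregular. -/
theorem lemma_eight_c
    (p q1 : ℕ) (M : Set ((Fin p → ℂ) × ((Fin q1 → ℂ) × ℂ)))
    (hM : ∀ a : Fin p → ℂ, Pluripolar {w : (Fin q1 → ℂ) × ℂ | (a, w) ∈ M})
    (A : Set (Fin p → ℂ)) (hA : LocPluriregular A) :
    LocPluriregular
      {c : (Fin p → ℂ) × (Fin q1 → ℂ) |
        c.1 ∈ A ∧ Pluripolar {t : ℂ | (c.1, (c.2, t)) ∈ M}} := by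
  have h := locPluriregular_of_pluripolar_compl_fibers hA
    (P := fun a => {b | ¬ Pluripolar {t : ℂ | (a, (b, t)) ∈ M}})
    fun a => (hM a).not_pluripolar_fiber
  simpa only [mem_ofPred_eq, not_not] using h
end
end

section
/- Let D_j ⊆ ℂ^{n_j} be a pseudoconvex domain and A_j ⊆ D_j a locally pluriregular set (j = 1,…,N, N ≥ 2), let X := 𝕏(A_1,…,A_N;D_1,…,D_N), let U be an open neighborhood of X, and let M ⊆ U be relatively closed such that for each j ∈ {1,…,N} the set Σ_j := {(z',z'') ∈ (A_1×⋯×A_{j-1})×(A_{j+1}×⋯×A_N) : the fiber M_{(z',·,z'')} is not pluripolar} is pluripolar. Put X' := 𝕋(A_1,…,A_N;D_1,…,D_N;Σ_1,…,Σ_N). Then the set X'∖M is not pluripolar. -/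
open Set Metric Filter

noncomputable section

section EReal

theorem EReal.exists_coe_add_lt {x y : EReal} {r : ℝ} (hx : x < ⊤) (hy : y < ⊤)
    (h : x + y < (r : EReal)) :
    ∃ c d : ℝ, x < (c : EReal) ∧ y < (d : EReal) ∧ c + d < r := by
  induction x with
  | top => exact absurd hx (lt_irrefl _)
  | bot =>
    obtain ⟨d, hd, -⟩ := EReal.lt_iff_exists_real_btwn.1 hy
    exact ⟨r - d - 1, d, EReal.bot_lt_coe _, hd, by linarith⟩
  | coe a =>
    induction y with
    | top => exact absurd hy (lt_irrefl _)
    | bot =>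
      exact ⟨a + 1, r - a - 2, by exact_mod_cast lt_add_one a, EReal.bot_lt_coe _, by linarith⟩
    | coe b =>
      have h' : a + b < r := by exact_mod_cast h
      exact ⟨a + (r - a - b) / 3, b + (r - a - b) / 3,
        by exact_mod_cast (by linarith : a < a + (r - a - b) / 3),
        by exact_mod_cast (by linarith : b < b + (r - a - b) / 3), by linarith⟩

theorem EReal.add_le_coe_of_le_of_le_sub {x y : EReal} {r c : ℝ} (hx : x ≤ (c : EReal))
    (hy : y ≤ ((r - c : ℝ) : EReal)) : x + y ≤ (r : EReal) := by
  refine (add_le_add hx hy).trans ?_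
  rw [← EReal.coe_add]
  exact_mod_cast (by linarith : c + (r - c) ≤ r)

theorem EReal.eq_bot_of_forall_nat_le {x : EReal} {b c : ℝ} (hc : 0 < c)
    (h : ∀ k : ℕ, x ≤ ((b - k * c : ℝ) : EReal)) : x = ⊥ := by
  induction x with
  | bot => rfl
  | top => simpa using h 0
  | coe a =>
    obtain ⟨k, hk⟩ := exists_nat_gt ((b - a) / c)
    rw [div_lt_iff₀ hc] at hk
    have := EReal.coe_le_coe_iff.1 (h k)
    linarith

theorem EReal.coe_mul_add_one_lt_coe_iff {ε : ℝ} (hε : 0 < ε) (x : EReal) (r : ℝ) :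
    (ε : EReal) * x + 1 < (r : EReal) ↔ x < (((r - 1) / ε : ℝ) : EReal) := by
  induction x with
  | bot => simp [EReal.coe_mul_bot_of_pos hε]
  | top => simp [EReal.coe_mul_top_of_pos hε,
      EReal.top_add_of_ne_bot (x := 1) (EReal.coe_ne_bot 1)]
  | coe a =>
    rw [← EReal.coe_mul, ← EReal.coe_one, ← EReal.coe_add, EReal.coe_lt_coe_iff,
      EReal.coe_lt_coe_iff, lt_div_iff₀ hε]
    constructor <;> intro h <;> linarith

theorem EReal.coe_mul_add_one_le_coe_iff {ε : ℝ} (hε : 0 < ε) (x : EReal) (r : ℝ) :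
    (ε : EReal) * x + 1 ≤ (r : EReal) ↔ x ≤ (((r - 1) / ε : ℝ) : EReal) := by
  induction x with
  | bot => simp [EReal.coe_mul_bot_of_pos hε]
  | top => simp [EReal.coe_mul_top_of_pos hε,
      EReal.top_add_of_ne_bot (x := 1) (EReal.coe_ne_bot 1)]
  | coe a =>
    rw [← EReal.coe_mul, ← EReal.coe_one, ← EReal.coe_add, EReal.coe_le_coe_iff,
      EReal.coe_le_coe_iff, le_div_iff₀ hε]
    constructor <;> intro h <;> linarith

end EReal

section Separation

/-- Strict insertion of a continuous function between an upper and a lower semicontinuous one. -/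
theorem exists_continuous_lt_sub_of_add_lt {X : Type*} [TopologicalSpace X] [NormalSpace X]
    [ParacompactSpace X] {u v : X → EReal} (hu : UpperSemicontinuous u)
    (hv : UpperSemicontinuous v) (hu_top : ∀ x, u x < ⊤) (hv_top : ∀ x, v x < ⊤)
    {g : X → ℝ} (hg : Continuous g) (h : ∀ x, u x + v x < (g x : EReal)) :
    ∃ φ : C(X, ℝ), ∀ x, u x < (φ x : EReal) ∧ v x < ((g x - φ x : ℝ) : EReal) := by
  have hconv : ∀ x, Convex ℝ {y : ℝ | u x < (y : EReal) ∧ v x < ((g x - y : ℝ) : EReal)} := by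
    intro x
    refine Set.OrdConnected.convex ⟨?_⟩
    rintro a ⟨ha, -⟩ b ⟨-, hb⟩ y ⟨hay, hyb⟩
    exact ⟨ha.trans_le (by exact_mod_cast hay),
      hb.trans_le (by exact_mod_cast (by linarith : g x - b ≤ g x - y))⟩
  refine exists_continuous_forall_mem_convex_of_local_const hconv fun x => ?_
  obtain ⟨c, d, hc, hd, hcd⟩ := EReal.exists_coe_add_lt (hu_top x) (hv_top x) (h x)
  refine ⟨c, ?_⟩
  filter_upwards [hu x _ hc, hv x _ hd, hg.continuousAt.eventually (lt_mem_nhds hcd)]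
    with y h1 h2 h3
  exact ⟨h1, h2.trans (by exact_mod_cast (by linarith : d < g y - c))⟩

theorem exists_differentiable_re_eq_of_mem_span_fourier {g : C(UnitAddCircle, ℂ)}
    (hg : g ∈ Submodule.span ℂ (range (fourier (T := 1)))) :
    ∀ a : ℂ, ∃ F : ℂ → ℂ, Differentiable ℂ F ∧
      ∀ θ : UnitAddCircle, (F (AddCircle.toCircle θ)).re = (a * g θ).re := by
  induction hg using Submodule.span_induction with
  | mem x hx =>
    obtain ⟨k, rfl⟩ := hx
    intro a
    obtain ⟨m, rfl | rfl⟩ := k.eq_nat_or_neg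
    · refine ⟨fun z => a * z ^ m, by fun_prop, fun θ => ?_⟩
      rw [fourier_apply, AddCircle.toCircle_zsmul]
      simp
    · refine ⟨fun z => (starRingEnd ℂ) a * z ^ m, by fun_prop, fun θ => ?_⟩
      rw [fourier_neg, fourier_apply, AddCircle.toCircle_zsmul, ← Complex.conj_re]
      simp
  | zero => exact fun a => ⟨fun _ => 0, by fun_prop, by simp⟩
  | add x y _ _ hx hy =>
    intro a
    obtain ⟨F, hF, hFx⟩ := hx a
    obtain ⟨G, hG, hGy⟩ := hy a
    refine ⟨fun z => F z + G z, by fun_prop, fun θ => ?_⟩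
    simp only [Complex.add_re, hFx, hGy, ContinuousMap.add_apply, mul_add]
  | smul b x _ hx =>
    intro a
    obtain ⟨F, hF, hFx⟩ := hx (a * b)
    refine ⟨F, hF, fun θ => ?_⟩
    rw [hFx, ContinuousMap.smul_apply, smul_eq_mul, mul_assoc]

/-- Continuous real functions on the circle are uniformly approximated by real parts of entire
functions. -/
theorem exists_differentiable_abs_re_sub_lt (φ : C(UnitAddCircle, ℝ)) {ε : ℝ} (hε : 0 < ε) :
    ∃ F : ℂ → ℂ, Differentiable ℂ F ∧
      ∀ θ : UnitAddCircle, |(F (AddCircle.toCircle θ)).re - φ θ| < ε := by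
  let ψ : C(UnitAddCircle, ℂ) := ⟨fun θ => (φ θ : ℂ), by fun_prop⟩
  have hψ : ψ ∈ closure (Submodule.span ℂ (range (fourier (T := 1))) :
      Set C(UnitAddCircle, ℂ)) := by
    rw [← Submodule.topologicalClosure_coe, span_fourier_closure_eq_top]
    trivial
  obtain ⟨g, hg, hdist⟩ := Metric.mem_closure_iff.1 hψ ε hε
  obtain ⟨F, hF, hFg⟩ := exists_differentiable_re_eq_of_mem_span_fourier hg 1
  refine ⟨F, hF, fun θ => ?_⟩
  have h1 : dist (ψ θ) (g θ) < ε := (ContinuousMap.dist_apply_le_dist θ).trans_lt hdist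
  rw [dist_comm, dist_eq_norm] at h1
  have h2 := (Complex.abs_re_le_norm (g θ - ψ θ)).trans_lt h1
  rw [hFg, one_mul]
  simpa [ψ] using h2

/-- If `u + v ≤ Re f` on a circle, the two summands can be separated, up to `ε`, by the real part
of an entire function. -/
theorem exists_differentiable_le_re_of_add_le {c : ℂ} {r : ℝ} (hr : 0 < r) {u v : ℂ → EReal}
    (hu : UpperSemicontinuousOn u (sphere c r)) (hv : UpperSemicontinuousOn v (sphere c r))
    (hu_top : ∀ t ∈ sphere c r, u t < ⊤) (hv_top : ∀ t ∈ sphere c r, v t < ⊤)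
    {f : ℂ → ℂ} (hf : ContinuousOn f (sphere c r))
    (h : ∀ t ∈ sphere c r, u t + v t ≤ ((f t).re : EReal)) {ε : ℝ} (hε : 0 < ε) :
    ∃ F : ℂ → ℂ, Differentiable ℂ F ∧ ∀ t ∈ sphere c r,
      u t ≤ ((F t).re : EReal) ∧ v t ≤ (((f t).re + ε - (F t).re : ℝ) : EReal) := by
  let p : UnitAddCircle → ℂ := fun θ => c + r * AddCircle.toCircle θ
  have hp : Continuous p := by
    have := AddCircle.continuous_toCircle (T := (1 : ℝ))
    fun_prop
  have hps : ∀ θ, p θ ∈ sphere c r := fun θ => by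
    simp [p, abs_of_pos hr, Circle.norm_coe]
  obtain ⟨φ, hφ⟩ := exists_continuous_lt_sub_of_add_lt
    (u := u ∘ p) (v := v ∘ p) (g := fun θ => (f (p θ)).re + ε / 2)
    (upperSemicontinuousOn_univ_iff.1 (hu.comp hp.continuousOn fun θ _ => hps θ))
    (upperSemicontinuousOn_univ_iff.1 (hv.comp hp.continuousOn fun θ _ => hps θ))
    (fun θ => hu_top _ (hps θ)) (fun θ => hv_top _ (hps θ))
    (by
      have : Continuous fun θ => f (p θ) := hf.comp_continuous hp hps
      exact (Complex.continuous_re.comp this).add continuous_const)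
    (fun θ => (h _ (hps θ)).trans_lt (by
      exact_mod_cast (by linarith : (f (p θ)).re < (f (p θ)).re + ε / 2)))
  obtain ⟨G, hG, hGφ⟩ := exists_differentiable_abs_re_sub_lt φ (ε := ε / 4) (by positivity)
  refine ⟨fun t => G ((t - c) / r) + (ε / 4 : ℝ), by fun_prop, fun t ht => ?_⟩
  have hr' : (r : ℂ) ≠ 0 := by exact_mod_cast hr.ne'
  have hz : (t - c) / r ∈ sphere (0 : ℂ) 1 := by
    rw [mem_sphere, dist_eq_norm] at ht
    simp [ht, abs_of_pos hr, hr.ne']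
  obtain ⟨θ, hθ⟩ := (AddCircle.homeomorphCircle (one_ne_zero (α := ℝ))).surjective
    ⟨(t - c) / r, by simpa [Submonoid.unitSphere] using hz⟩
  rw [AddCircle.homeomorphCircle_apply] at hθ
  have hθ' : ((AddCircle.toCircle θ : Circle) : ℂ) = (t - c) / r := by rw [hθ]
  have hpt : p θ = t := by
    simp only [p, hθ']
    field_simp
    ring
  have h1 := hφ θ
  have h2 := abs_lt.1 (hGφ θ)
  rw [hθ'] at h2
  simp only [Function.comp_apply, hpt] at h1
  refine ⟨h1.1.le.trans ?_, h1.2.le.trans ?_⟩ <;>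
  · simp only [Complex.add_re, Complex.ofReal_re, EReal.coe_le_coe_iff]
    linarith [h2.1, h2.2]

end Separation

section Plurisubharmonic

variable {E : Type*} [NormedAddCommGroup E] [NormedSpace ℂ E]

theorem PshOn.upperSemicontinuous {u : E → EReal} (hu : PshOn u univ) :
    UpperSemicontinuous u :=
  upperSemicontinuousOn_univ_iff.1 hu.2.1

theorem PshOn.lt_top {u : E → EReal} (hu : PshOn u univ) (x : E) : u x < ⊤ :=
  hu.1 x (mem_univ x)

theorem PshOn.le_re {u : E → EReal} (hu : PshOn u univ) (a b : E) {c : ℂ} {r : ℝ} (hr : 0 < r)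
    {f : ℂ → ℂ} (hf : ContinuousOn f (closedBall c r)) (hf' : DifferentiableOn ℂ f (ball c r))
    (h : ∀ t ∈ sphere c r, u (a + t • b) ≤ ((f t).re : EReal)) {t : ℂ}
    (ht : t ∈ closedBall c r) : u (a + t • b) ≤ ((f t).re : EReal) :=
  hu.2.2 a b c r hr (fun _ _ => mem_univ _) f hf hf' h t ht

theorem PshOn.upperSemicontinuous_line {u : E → EReal} (hu : PshOn u univ) (a b : E) :
    UpperSemicontinuous fun t : ℂ => u (a + t • b) :=
  hu.upperSemicontinuous.comp (g := fun t : ℂ => a + t • b) (by fun_prop)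

theorem PshOn.exists_lt_on_sphere {u : E → EReal} (hu : PshOn u univ) (a b : E) (c : ℂ) {r : ℝ}
    (hr : 0 < r) : ∃ B : ℝ, ∀ t ∈ sphere c r, u (a + t • b) < (B : EReal) := by
  obtain ⟨t₀, -, ht₀⟩ := UpperSemicontinuousOn.exists_isMaxOn
    (NormedSpace.sphere_nonempty.2 hr.le) (isCompact_sphere c r)
    ((hu.upperSemicontinuous_line a b).upperSemicontinuousOn _)
  obtain ⟨B, hB, -⟩ := EReal.lt_iff_exists_real_btwn.1 (hu.lt_top (a + t₀ • b))
  exact ⟨B, fun t ht => (ht₀ ht).trans_lt hB⟩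

theorem PshOn.comp_affine_s14 {F : Type*} [NormedAddCommGroup F] [NormedSpace ℂ F] {u : E → EReal}
    (hu : PshOn u univ) {g : F → E} (hg : Continuous g) (l : F → E)
    (hgl : ∀ (a b : F) (t : ℂ), g (a + t • b) = g a + t • l b) :
    PshOn (fun x => u (g x)) univ := by
  refine ⟨fun x _ => hu.lt_top _,
    (hu.upperSemicontinuous.comp hg).upperSemicontinuousOn _, ?_⟩
  intro a b c r hr _ f hf hf' h t ht
  simp only [hgl] at h ⊢
  exact hu.le_re _ _ hr hf hf' h ht

theorem PshOn.add {u v : E → EReal} (hu : PshOn u univ) (hv : PshOn v univ) :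
    PshOn (fun x => u x + v x) univ := by
  refine ⟨fun x _ => EReal.add_lt_top (hu.lt_top x).ne (hv.lt_top x).ne,
    hu.2.1.add' hv.2.1 fun x _ => EReal.continuousAt_add (Or.inl (hu.lt_top x).ne)
      (Or.inr (hv.lt_top x).ne), ?_⟩
  intro a b c r hr _ f hf hf' h t ht
  refine EReal.le_of_forall_lt_iff_le.1 fun z hz => ?_
  have hε : 0 < z - (f t).re := sub_pos.2 (by exact_mod_cast hz)
  obtain ⟨F, hF, hF'⟩ := exists_differentiable_le_re_of_add_le hr
    ((hu.upperSemicontinuous_line a b).upperSemicontinuousOn _)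
    ((hv.upperSemicontinuous_line a b).upperSemicontinuousOn _)
    (fun _ _ => hu.lt_top _) (fun _ _ => hv.lt_top _)
    (hf.mono sphere_subset_closedBall) h hε
  have h1 := hu.le_re a b hr hF.continuous.continuousOn hF.differentiableOn
    (fun s hs => (hF' s hs).1) ht
  have h2 := hv.le_re a b (f := fun s => f s + (z - (f t).re : ℝ) - F s) hr
    ((hf.add continuousOn_const).sub hF.continuous.continuousOn)
    ((hf'.add (differentiableOn_const _)).sub hF.differentiableOn)
    (fun s hs => by simpa only [Complex.add_re, Complex.sub_re, Complex.ofReal_re] using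
      (hF' s hs).2) ht
  refine EReal.add_le_coe_of_le_of_le_sub h1 (h2.trans_eq ?_)
  simp only [Complex.add_re, Complex.sub_re, Complex.ofReal_re]
  congr 1
  ring

theorem Complex.re_le_of_forall_sphere_re_le {F : ℂ → ℂ} (hF : Differentiable ℂ F) {c : ℂ} {r : ℝ}
    (hr : 0 < r) {M : ℝ} (h : ∀ t ∈ sphere c r, (F t).re ≤ M) {t : ℂ}
    (ht : t ∈ closedBall c r) : (F t).re ≤ M := by
  have := Complex.norm_le_of_forall_mem_frontier_norm_le (f := fun z => Complex.exp (F z))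
    (isBounded_ball (x := c) (r := r)) (C := Real.exp M)
    (hF.cexp.diffContOnCl)
    (fun z hz => by
      rw [frontier_ball c hr.ne'] at hz
      rw [Complex.norm_exp]
      exact Real.exp_le_exp.2 (h z hz))
    (z := t) (by rwa [closure_ball c hr.ne'])
  rwa [Complex.norm_exp, Real.exp_le_exp] at this

/-- A form of Harnack's inequality. -/
theorem Complex.re_one_ge_of_re_le {F : ℂ → ℂ} (hF : Differentiable ℂ F) {M : ℝ}
    (h : ∀ t ∈ ball (0 : ℂ) 2, (F t).re ≤ M) : (F 0).re - 2 * (M + 1 - (F 0).re) ≤ (F 1).re := by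
  have h0 := h 0 (by simp)
  have := Complex.borelCaratheodory_zero (f := fun z => F z - F 0) (M := M + 1 - (F 0).re)
    (R := 2) (z := 1) (by linarith) (by fun_prop)
    (fun z hz => by
      simp only [mem_ofPred_eq, Complex.sub_re]
      linarith [h z hz])
    (by norm_num) (by simp) (by simp)
  have h1 := (abs_le.1 (Complex.abs_re_le_norm (F 1 - F 0))).1
  norm_num at this
  rw [Complex.sub_re] at h1
  linarith

/-- Two plurisubharmonic functions which are not identically `-∞` have a common point of
finiteness. -/
theorem PshOn.exists_ne_bot_and_ne_bot {u v : E → EReal} (hu : PshOn u univ) (hv : PshOn v univ)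
    {x₁ x₂ : E} (hx₁ : u x₁ ≠ ⊥) (hx₂ : v x₂ ≠ ⊥) : ∃ x, u x ≠ ⊥ ∧ v x ≠ ⊥ := by
  by_contra! hcon
  obtain ⟨B₁, hB₁⟩ := hu.exists_lt_on_sphere x₁ (x₂ - x₁) 0 two_pos
  obtain ⟨B₂, hB₂⟩ := hv.exists_lt_on_sphere x₁ (x₂ - x₁) 0 two_pos
  set B := max (max B₁ B₂) 0 with hB
  have hB0 : 0 ≤ B := le_max_right _ _
  have hBu : ∀ t ∈ sphere (0 : ℂ) 2, u (x₁ + t • (x₂ - x₁)) < (B : EReal) := fun t ht =>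
    (hB₁ t ht).trans_le (by exact_mod_cast (le_max_left _ _).trans (le_max_left _ _))
  have hBv : ∀ t ∈ sphere (0 : ℂ) 2, v (x₁ + t • (x₂ - x₁)) < (B : EReal) := fun t ht =>
    (hB₂ t ht).trans_le (by exact_mod_cast (le_max_right _ _).trans (le_max_left _ _))
  set α := (u x₁).toReal with hα
  have hα' : u x₁ = (α : EReal) := (EReal.coe_toReal (hu.lt_top _).ne hx₁).symm
  refine hx₂ (EReal.eq_bot_of_forall_nat_le (b := 1 - α + 2 * (B + 2 - α)) one_pos fun K => ?_)
  have hK : (0 : ℝ) ≤ K := K.cast_nonneg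
  have hadd : ∀ x y : EReal, x < (B : EReal) → y < (B : EReal) → (x ≠ ⊥ → y = ⊥) →
      max x ((-K - B : ℝ) : EReal) + max y ((-K - B : ℝ) : EReal) ≤ ((-K : ℝ) : EReal) := by
    have key : ∀ y : EReal, y < (B : EReal) →
        ((-K - B : ℝ) : EReal) + max y ((-K - B : ℝ) : EReal) ≤ ((-K : ℝ) : EReal) := by
      intro y hy
      refine EReal.add_le_coe_of_le_of_le_sub le_rfl (max_le (hy.le.trans ?_) ?_)
      · exact_mod_cast (by linarith : B ≤ -K - (-K - B))
      · exact_mod_cast (by linarith : -K - B ≤ -K - (-K - B))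
    intro x y hx hy hxy
    by_cases hxb : x = ⊥
    · rw [hxb, max_eq_right bot_le]
      exact key y hy
    · rw [hxy hxb, max_eq_right (a := ⊥) bot_le, add_comm]
      exact key x hx
  have husc : UpperSemicontinuous fun _ : ℂ => ((-K - B : ℝ) : EReal) :=
    continuous_const.upperSemicontinuous
  obtain ⟨F, hF, hF'⟩ := exists_differentiable_le_re_of_add_le (c := 0) (r := 2) two_pos
    (u := fun t => max (u (x₁ + t • (x₂ - x₁))) ((-K - B : ℝ) : EReal))
    (v := fun t => max (v (x₁ + t • (x₂ - x₁))) ((-K - B : ℝ) : EReal))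
    (((hu.upperSemicontinuous_line _ _).sup husc).upperSemicontinuousOn _)
    (((hv.upperSemicontinuous_line _ _).sup husc).upperSemicontinuousOn _)
    (fun t _ => max_lt (hu.lt_top _) (EReal.coe_lt_top _))
    (fun t _ => max_lt (hv.lt_top _) (EReal.coe_lt_top _))
    (f := fun _ => ((-K : ℝ) : ℂ)) continuousOn_const
    (fun t ht => by
      rw [Complex.ofReal_re]
      exact hadd _ _ (hBu t ht) (hBv t ht) (hcon _)) one_pos
  have hFB : ∀ t ∈ sphere (0 : ℂ) 2, (F t).re ≤ B + 1 := fun t ht => by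
    have := EReal.coe_le_coe_iff.1 ((le_max_right _ _).trans (hF' t ht).2)
    rw [Complex.ofReal_re] at this
    linarith
  have h0 : α ≤ (F 0).re := by
    have := hu.le_re x₁ (x₂ - x₁) two_pos hF.continuous.continuousOn hF.differentiableOn
      (fun s hs => (le_max_left _ _).trans (hF' s hs).1) (t := 0) (by simp)
    rw [zero_smul, add_zero, hα'] at this
    exact_mod_cast this
  have h1 := Complex.re_one_ge_of_re_le hF (M := B + 1) fun t ht =>
    Complex.re_le_of_forall_sphere_re_le hF two_pos hFB (ball_subset_closedBall ht)
  have h2 := hv.le_re x₁ (x₂ - x₁) (f := fun s => ((-K : ℝ) : ℂ) + (1 : ℝ) - F s) two_pos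
    (continuousOn_const.sub hF.continuous.continuousOn)
    ((differentiableOn_const _).sub hF.differentiableOn)
    (fun s hs => by
      simpa only [Complex.add_re, Complex.sub_re, Complex.ofReal_re] using
        (le_max_left _ _).trans (hF' s hs).2) (t := 1) (by simp)
  rw [one_smul, add_sub_cancel] at h2
  refine h2.trans ?_
  simp only [Complex.add_re, Complex.sub_re, Complex.ofReal_re, EReal.coe_le_coe_iff]
  linarith

/-- A plurisubharmonic function equal to `-∞` on a nonempty open set is identically `-∞`. -/
theorem PshOn.eq_bot_of_isOpen {u : E → EReal} (hu : PshOn u univ) {V : Set E} (hV : IsOpen V)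
    {x₀ : E} (hx₀ : x₀ ∈ V) (h : ∀ x ∈ V, u x = ⊥) (x : E) : u x = ⊥ := by
  obtain ⟨B, hB⟩ := hu.exists_lt_on_sphere x₀ (x - x₀) 1 one_pos
  have hV' : IsOpen ((fun t : ℂ => x₀ + t • (x - x₀)) ⁻¹' V) := hV.preimage (by fun_prop)
  obtain ⟨δ, hδ, hδV⟩ := Metric.isOpen_iff.1 hV' 0 (by simpa using hx₀)
  refine EReal.eq_bot_of_forall_nat_le (b := B) (c := 1 / 20) (by norm_num) fun K => ?_
  set s := min (δ ^ 2 / 4) (1 / 4) with hs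
  have hs0 : 0 < s := lt_min (by positivity) (by norm_num)
  have hsδ : s ≤ δ ^ 2 / 4 := min_le_left _ _
  have hs4 : s ≤ 1 / 4 := min_le_right _ _
  have hne : ∀ t ∈ closedBall (1 : ℂ) 1, (s : ℂ) + t ≠ 0 := by
    intro t ht h0
    have h1 : t.re = -s := by
      have := congrArg Complex.re h0
      simp at this
      linarith
    rw [mem_closedBall, dist_eq_norm] at ht
    have := (abs_le.1 ((Complex.abs_re_le_norm _).trans ht)).1
    simp at this
    linarith
  have hdiff : DifferentiableOn ℂ
      (fun t : ℂ => ((B + K * (3 / 4) : ℝ) : ℂ) - (K : ℂ) * ((s : ℂ) + t)⁻¹)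
      (closedBall 1 1) := by
    refine (differentiableOn_const _).sub ((differentiableOn_const _).mul ?_)
    exact ((differentiableOn_const _).add differentiableOn_id).inv hne
  have hre : ∀ t : ℂ, ((((B + K * (3 / 4) : ℝ) : ℂ) - (K : ℂ) * ((s : ℂ) + t)⁻¹)).re =
      B + K * (3 / 4 - (s + t.re) / Complex.normSq (s + t)) := by
    intro t
    rw [Complex.sub_re, Complex.ofReal_re, ← Complex.ofReal_natCast, Complex.re_ofReal_mul,
      Complex.inv_re, Complex.add_re, Complex.ofReal_re]
    ring
  have key := hu.le_re x₀ (x - x₀) one_pos hdiff.continuousOn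
    (hdiff.mono ball_subset_closedBall) (fun t ht => ?_) (t := 1) (by simp)
  · rw [one_smul, add_sub_cancel] at key
    refine key.trans ?_
    rw [hre, EReal.coe_le_coe_iff]
    have h1 : Complex.normSq ((s : ℂ) + 1) = (s + 1) ^ 2 := by
      simp [Complex.normSq_apply]
      ring
    have h2 : (4 : ℝ) / 5 ≤ (s + 1) / (s + 1) ^ 2 := by
      rw [div_le_div_iff₀ (by norm_num) (by positivity)]
      nlinarith
    rw [h1, Complex.one_re]
    nlinarith [K.cast_nonneg (α := ℝ)]
  · by_cases htδ : ‖t‖ < δ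
    · rw [h _ (hδV (by simpa using htδ))]
      exact bot_le
    · refine (hB t ht).le.trans ?_
      rw [hre, EReal.coe_le_coe_iff]
      have h1 : t.re ^ 2 + t.im ^ 2 = 2 * t.re := by
        rw [mem_sphere, dist_eq_norm] at ht
        have := Complex.sq_norm (t - 1)
        rw [ht, Complex.normSq_apply] at this
        simp at this
        linarith
      have h2 : δ ^ 2 ≤ 2 * t.re := by
        rw [← h1]
        have := Complex.sq_norm t
        rw [Complex.normSq_apply] at this
        nlinarith [not_lt.1 htδ]
      have h3 : Complex.normSq ((s : ℂ) + t) = s ^ 2 + (1 + s) * (2 * t.re) := by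
        rw [Complex.normSq_apply]
        simp
        linarith
      have h4 : (s + t.re) / Complex.normSq ((s : ℂ) + t) ≤ 3 / 4 := by
        rw [h3, div_le_div_iff₀ (by nlinarith [sq_nonneg δ]) (by norm_num)]
        nlinarith [sq_nonneg δ]
      nlinarith [K.cast_nonneg (α := ℝ)]

theorem PshOn.coe_mul_add_one {u : E → EReal} (hu : PshOn u univ) (Ω : Set E) {ε : ℝ}
    (hε : 0 < ε) : PshOn (fun x => (ε : EReal) * u x + 1) Ω := by
  have hlt : ∀ x, (ε : EReal) * u x + 1 < ⊤ := fun x => by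
    obtain ⟨c, hc, -⟩ := EReal.lt_iff_exists_real_btwn.1 (hu.lt_top x)
    refine lt_trans ((EReal.coe_mul_add_one_lt_coe_iff hε _ (ε * c + 1)).2 ?_)
      (EReal.coe_lt_top _)
    rwa [add_sub_cancel_right, mul_div_cancel_left₀ _ hε.ne']
  refine ⟨fun x _ => hlt x, UpperSemicontinuous.upperSemicontinuousOn ?_ Ω, ?_⟩
  · intro x y hy
    obtain ⟨c, hc, hcy⟩ := EReal.lt_iff_exists_real_btwn.1 hy
    filter_upwards [hu.upperSemicontinuous x _ ((EReal.coe_mul_add_one_lt_coe_iff hε _ _).1 hc)]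
      with z hz
    exact ((EReal.coe_mul_add_one_lt_coe_iff hε _ _).2 hz).trans hcy
  · intro a b c r hr _ f hf hf' h t ht
    have hfr : ∀ s, ((f s - 1) / (ε : ℂ)).re = ((f s).re - 1) / ε := fun s => by
      rw [Complex.div_ofReal_re, Complex.sub_re, Complex.one_re]
    rw [EReal.coe_mul_add_one_le_coe_iff hε, ← hfr]
    refine hu.le_re a b (f := fun s => (f s - 1) / (ε : ℂ)) hr (by fun_prop) (by fun_prop)
      (fun s hs => ?_) ht
    rw [hfr, ← EReal.coe_mul_add_one_le_coe_iff hε]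
    exact h s hs

/-- A plurisubharmonic function equal to `-∞` on a locally pluriregular set is identically
`-∞`. -/
theorem LocPluriregular.eq_bot_of_pshOn {A : Set E} (hA : LocPluriregular A) {u : E → EReal}
    (hu : PshOn u univ) (h : ∀ x ∈ A, u x = ⊥) (x : E) : u x = ⊥ := by
  by_contra hx
  obtain ⟨⟨a, ha⟩, hreg⟩ := hA
  have hΩ : IsOpen {y | u y < 0} := hu.upperSemicontinuous.isOpen_preimage 0
  have haΩ : a ∈ {y | u y < 0} := by
    rw [mem_ofPred_eq, h a ha]
    exact EReal.bot_lt_zero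
  have hextr : ∀ z ∈ {y | u y < 0}, u z ≠ ⊥ →
      1 ≤ relExtr (A ∩ {y | u y < 0}) {y | u y < 0} z := by
    intro z hz hzb
    set α := (u z).toReal with hα
    have hα' : u z = (α : EReal) := (EReal.coe_toReal (hu.lt_top _).ne hzb).symm
    have hα0 : α < 0 := by
      have : u z < 0 := hz
      rw [hα'] at this
      exact_mod_cast this
    refine EReal.ge_of_forall_gt_iff_ge.1 fun c hc => ?_
    have hc1 : c < 1 := by exact_mod_cast hc
    have hε : 0 < (1 - c) / (-α) := div_pos (by linarith) (by linarith)
    have hmem : (fun y => (((1 - c) / (-α) : ℝ) : EReal) * u y + 1) ∈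
        extrFamily (A ∩ {y | u y < 0}) {y | u y < 0} := by
      refine ⟨hu.coe_mul_add_one _ hε, fun y hy => ?_, fun y hy => ?_⟩
      · refine (EReal.coe_mul_add_one_le_coe_iff hε (u y) 1).2 ?_
        simpa using (le_of_lt hy : u y ≤ 0)
      · refine (EReal.coe_mul_add_one_le_coe_iff hε (u y) 0).2 ?_
        rw [h y hy.1]
        exact bot_le
    refine le_trans (le_of_eq ?_)
      (le_iSup₂ (f := fun (w : E → EReal) (_ : w ∈ extrFamily (A ∩ {y | u y < 0})
        {y | u y < 0}) => w z) _ hmem)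
    simp only [hα']
    rw [← EReal.coe_mul, ← EReal.coe_one, ← EReal.coe_add, EReal.coe_eq_coe_iff]
    rw [div_mul_eq_mul_div, div_neg, mul_div_cancel_right₀ _ hα0.ne]
    ring
  have hfreq : ∃ᶠ z in nhds a, 1 ≤ relExtr (A ∩ {y | u y < 0}) {y | u y < 0} z := by
    intro hev
    obtain ⟨V, hV, hVo, haV⟩ := _root_.mem_nhds_iff.1 (hev.and (hΩ.mem_nhds haΩ))
    refine hx (hu.eq_bot_of_isOpen hVo haV (fun z hz => ?_) x)
    by_contra hzb
    exact (hV hz).1 (hextr z (hV hz).2 hzb)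
  have h1 : (1 : EReal) ≤ relExtrStar (A ∩ {y | u y < 0}) {y | u y < 0} a :=
    Filter.le_limsup_of_frequently_le hfreq
  rw [hreg a ha _ hΩ haΩ] at h1
  exact absurd h1 (by norm_num)

end Plurisubharmonic

section Products

/-- A plurisubharmonic function equal to `-∞` on a product of locally pluriregular sets is
identically `-∞`. -/
theorem PshOn.eq_bot_of_pi {ι : Type*} [Fintype ι] {E : ι → Type*}
    [∀ i, NormedAddCommGroup (E i)] [∀ i, NormedSpace ℂ (E i)] {A : ∀ i, Set (E i)}
    (hA : ∀ i, LocPluriregular (A i)) {u : (∀ i, E i) → EReal} (hu : PshOn u univ)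
    (h : ∀ z, (∀ i, z i ∈ A i) → u z = ⊥) (z : ∀ i, E i) : u z = ⊥ := by
  classical
  suffices H : ∀ (s : Finset ι) (z : ∀ i, E i), (∀ i ∉ s, z i ∈ A i) → u z = ⊥ from
    H Finset.univ z (by simp)
  intro s
  induction s using Finset.induction_on with
  | empty => exact fun z hz => h z fun i => hz i (by simp)
  | insert k s _ ih =>
    intro z hz
    have hpsh : PshOn (fun w => u (Function.update z k w)) univ := by
      refine hu.comp_affine_s14 (by fun_prop) (fun w => Function.update 0 k w) fun a b t => ?_
      ext i
      by_cases hi : i = k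
      · subst hi
        simp
      · simp [hi]
    have := (hA k).eq_bot_of_pshOn hpsh (fun w hw => ih _ fun i hi => ?_) (z k)
    · simpa using this
    · by_cases hik : i = k
      · subst hik
        simpa using hw
      · rw [Function.update_of_ne hik]
        exact hz i (by simp [hik, hi])

variable {N : ℕ} {n : Fin N → ℕ}

theorem glueAt_self (j : Fin N) (y : ∀ i : {i : Fin N // i ≠ j}, Fin (n i.1) → ℂ)
    (w : Fin (n j) → ℂ) : glueAt j y w j = w := by
  simp [glueAt]

theorem glueAt_of_ne {j i : Fin N} (h : i ≠ j)
    (y : ∀ i : {i : Fin N // i ≠ j}, Fin (n i.1) → ℂ) (w : Fin (n j) → ℂ) :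
    glueAt j y w i = y ⟨i, h⟩ := by
  simp [glueAt, h]

theorem dropAt_glueAt (j : Fin N) (y : ∀ i : {i : Fin N // i ≠ j}, Fin (n i.1) → ℂ)
    (w : Fin (n j) → ℂ) : dropAt j (glueAt j y w) = y :=
  funext fun i => glueAt_of_ne i.2 y w

theorem glueAt_dropAt (j : Fin N) (z : ∀ i, Fin (n i) → ℂ) :
    glueAt j (dropAt j z) (z j) = z := by
  funext i
  by_cases h : i = j
  · subst h
    exact glueAt_self _ _ _
  · exact glueAt_of_ne h _ _

theorem continuous_glueAt (j : Fin N) :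
    Continuous fun p : (∀ i : {i : Fin N // i ≠ j}, Fin (n i.1) → ℂ) × (Fin (n j) → ℂ) =>
      glueAt j p.1 p.2 := by
  refine continuous_pi fun i => ?_
  by_cases h : i = j
  · subst h
    simp only [glueAt_self]
    exact continuous_snd
  · simp only [glueAt_of_ne h]
    exact (continuous_apply _).comp continuous_fst

theorem glueAt_add_smul (j : Fin N) (y y' : ∀ i : {i : Fin N // i ≠ j}, Fin (n i.1) → ℂ)
    (w w' : Fin (n j) → ℂ) (t : ℂ) :
    glueAt j (y + t • y') (w + t • w') = glueAt j y w + t • glueAt j y' w' := by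
  funext i
  by_cases h : i = j
  · subst h
    simp only [Pi.add_apply, Pi.smul_apply, glueAt_self]
  · simp only [Pi.add_apply, Pi.smul_apply, glueAt_of_ne h]

theorem PshOn.glueAt_right {u : (∀ i, Fin (n i) → ℂ) → EReal} (hu : PshOn u univ) (j : Fin N)
    (y : ∀ i : {i : Fin N // i ≠ j}, Fin (n i.1) → ℂ) :
    PshOn (fun w => u (glueAt j y w)) univ :=
  hu.comp_affine_s14 ((continuous_glueAt j).comp (by fun_prop : Continuous fun w => (y, w)))
    (fun w => glueAt j 0 w) fun a b t => by
      simpa using glueAt_add_smul j y 0 a b t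

theorem PshOn.glueAt_left {u : (∀ i, Fin (n i) → ℂ) → EReal} (hu : PshOn u univ) (j : Fin N)
    (w : Fin (n j) → ℂ) : PshOn (fun y => u (glueAt j y w)) univ :=
  hu.comp_affine_s14 ((continuous_glueAt j).comp (by fun_prop : Continuous fun y => (y, w)))
    (fun y => glueAt j y 0) fun a b t => by
      simpa using glueAt_add_smul j a b w 0 t

/-- Outside `Σ_j`, a plurisubharmonic function equal to `-∞` on the complement of `M` in the
generalized cross is identically `-∞` on the whole fiber in the direction `j`. -/
theorem eq_bot_of_eq_bot_on_crossT_diff {D A : ∀ j : Fin N, Set (Fin (n j) → ℂ)}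
    {U M : Set (∀ j, Fin (n j) → ℂ)} (hXU : CrossN A D ⊆ U) (hM : RelClosedIn M U)
    {u : (∀ i, Fin (n i) → ℂ) → EReal} (hu : PshOn u univ)
    (h : ∀ z ∈ CrossT A D (SigmaSet A M) \ M, u z = ⊥) {j : Fin N} (hDo : IsOpen (D j))
    (hDne : (D j).Nonempty) {y : ∀ i : {i : Fin N // i ≠ j}, Fin (n i.1) → ℂ}
    (hyA : ∀ i, y i ∈ A i.1) (hy : y ∉ SigmaSet A M j) (w : Fin (n j) → ℂ) :
    u (glueAt j y w) = ⊥ := by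
  have hpp : Pluripolar {w : Fin (n j) → ℂ | glueAt j y w ∈ M} := by
    by_contra hcon
    exact hy ⟨hyA, hcon⟩
  have hA' : ∀ w, ∀ i, i ≠ j → glueAt j y w i ∈ A i := fun w i hi => by
    rw [glueAt_of_ne hi]
    exact hyA ⟨i, hi⟩
  obtain ⟨v, hv, hvne, hvM⟩ := hpp
  obtain ⟨d₀, hd₀⟩ := hDne
  obtain ⟨d, hd, hvd⟩ : ∃ d ∈ D j, v d ≠ ⊥ := by
    by_contra! hcon
    exact hvne (hv.eq_bot_of_isOpen hDo hd₀ hcon)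
  have hcont : Continuous fun w => glueAt j y w :=
    (continuous_glueAt j).comp (by fun_prop : Continuous fun w => (y, w))
  refine (hu.glueAt_right j y).eq_bot_of_isOpen
    (V := D j ∩ (fun w => glueAt j y w) ⁻¹' (closure M)ᶜ)
    (hDo.inter (isClosed_closure.isOpen_compl.preimage hcont)) (x₀ := d) ⟨hd, fun hdM => ?_⟩
    (fun w hw => h _ ⟨⟨j, ?_, hA' w, ?_⟩, fun hwM => hw.2 (subset_closure hwM)⟩) w
  · refine hvd (hvM d (hM.2 ⟨hdM, hXU ⟨j, ?_, hA' d⟩⟩))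
    rwa [glueAt_self]
  · rw [glueAt_self]
    exact hw.1
  · rwa [dropAt_glueAt]

end Products

/-- Under the hypotheses of the Main Theorem (each `Σ_j` pluripolar), the set `X'∖M` is not
pluripolar, where `X' := 𝕋(A_1,…,A_N;D_1,…,D_N;Σ_1,…,Σ_N)`. -/
theorem crossT_diff_not_pluripolar
    {N : ℕ} (hN : 2 ≤ N) {n : Fin N → ℕ}
    (D A : ∀ j : Fin N, Set (Fin (n j) → ℂ))
    (hD : ∀ j, IsConnected (D j) ∧ Pseudoconvex (D j))
    (hA : ∀ j, LocPluriregular (A j) ∧ A j ⊆ D j)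
    (U : Set (∀ j, Fin (n j) → ℂ)) (hUopen : IsOpen U) (hXU : CrossN A D ⊆ U)
    (M : Set (∀ j, Fin (n j) → ℂ)) (hM : RelClosedIn M U)
    (hSigma : ∀ j, Pluripolar (SigmaSet A M j)) :
    ¬ Pluripolar (CrossT A D (SigmaSet A M) \ M) := by
  rintro ⟨u, hu, hune, hubot⟩
  let j : Fin N := ⟨0, by lia⟩
  obtain ⟨z₀, hz₀⟩ := not_forall.1 hune
  obtain ⟨v, hv, hvne, hvbot⟩ := hSigma j
  obtain ⟨y₀, hy₀⟩ := not_forall.1 hvne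
  have hv' : PshOn (fun y => u (glueAt j y (z₀ j))) univ := hu.glueAt_left j (z₀ j)
  have hne : u (glueAt j (dropAt j z₀) (z₀ j)) ≠ ⊥ := by
    rwa [glueAt_dropAt]
  obtain ⟨y, hy1, hy2⟩ := hv.exists_ne_bot_and_ne_bot hv' hy₀ hne
  have hsum := (hv.add hv').eq_bot_of_pi (fun i => (hA i.1).1) (fun y hyA => ?_) y
  · exact (EReal.add_eq_bot_iff.1 hsum).elim hy1 hy2
  · by_cases hyS : y ∈ SigmaSet A M j
    · simp only [hvbot y hyS, EReal.bot_add]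
    · simp only [eq_bot_of_eq_bot_on_crossT_diff hXU hM hu hubot (hD j).2.1 (hD j).1.nonempty
        hyA hyS, EReal.add_bot]
end
end
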